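/- For every w ≥ 0 there exists a unique point q^w ∈ [0,∞)^d such that θ·q^w = w and µ₁C₁′(q^w₁) = µ₂C₂′(q^w₂) = ⋯ = µ_d C_d′(q^w_d). -/

import Mathlib

/-- A cost function `C` with derivative `C'`, as in the generalized cμ rule setting:
`C : [0,∞) → [0,∞)` is strictly increasing, strictly convex, continuously
differentiable, with `C(0) = C'(0) = 0`. -/
structure CostFun where
  C : ℝ → ℝ
  C' : ℝ → ℝ
  nonneg : ∀ x ≥ (0:ℝ), 0 ≤ C x
  strictMono : StrictMonoOn C (Set.Ici (0:ℝ))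
  strictConvex : StrictConvexOn ℝ (Set.Ici (0:ℝ)) C
  hasDeriv : ∀ x ≥ (0:ℝ), HasDerivWithinAt C (C' x) (Set.Ici (0:ℝ)) x
  contDeriv : ContinuousOn C' (Set.Ici (0:ℝ))
  zero : C 0 = 0
  deriv_zero : C' 0 = 0

theorem CostFun.strictMonoOn_deriv (c : CostFun) : StrictMonoOn c.C' (Set.Ici 0) := by
  intro x hx y hy hxy
  exact (c.strictConvex.lt_slope_of_hasDerivWithinAt hx hy hxy (c.hasDeriv x hx)).trans
    (c.strictConvex.slope_lt_of_hasDerivWithinAt hx hy hxy (c.hasDeriv y hy))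

theorem CostFun.continuousOn (c : CostFun) : ContinuousOn c.C (Set.Ici 0) :=
  fun x hx => (c.hasDeriv x hx).continuousWithinAt

/-- The vectors in the nonnegative orthant with weighted sum `w`. -/
def weightedSimplex {ι : Type*} [Fintype ι] (θ : ι → ℝ) (w : ℝ) : Set (ι → ℝ) :=
  {q | (∀ i, 0 ≤ q i) ∧ ∑ i, θ i * q i = w}

section weightedSimplex

variable {ι : Type*} [Fintype ι] {θ : ι → ℝ} {w : ℝ}

theorem convex_weightedSimplex : Convex ℝ (weightedSimplex θ w) := by
  rintro p ⟨hp, hpw⟩ q ⟨hq, hqw⟩ a b ha hb hab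
  refine ⟨fun i => ?_, ?_⟩
  · have := hp i
    have := hq i
    simp only [Pi.add_apply, Pi.smul_apply, smul_eq_mul]
    positivity
  · calc ∑ i, θ i * (a • p + b • q) i
        = a * ∑ i, θ i * p i + b * ∑ i, θ i * q i := by
          simp only [Pi.add_apply, Pi.smul_apply, smul_eq_mul, Finset.mul_sum,
            ← Finset.sum_add_distrib]
          exact Finset.sum_congr rfl fun i _ => by ring
      _ = w := by rw [hpw, hqw, ← add_mul, hab, one_mul]

theorem isCompact_weightedSimplex (hθ : ∀ i, 0 < θ i) : IsCompact (weightedSimplex θ w) := by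
  refine (isCompact_univ_pi fun i => isCompact_Icc (a := (0 : ℝ)) (b := w / θ i)).of_isClosed_subset
    ?_ fun q ⟨hq, hqw⟩ i _ => ⟨hq i, ?_⟩
  · have h : weightedSimplex θ w =
        (⋂ i, {q : ι → ℝ | 0 ≤ q i}) ∩ {q | ∑ i, θ i * q i = w} := by
      ext q
      simp [weightedSimplex]
    rw [h]
    exact (isClosed_iInter fun i => isClosed_le continuous_const (continuous_apply i)).inter
      (isClosed_eq (by fun_prop) continuous_const)
  · rw [le_div_iff₀ (hθ i), ← hqw, mul_comm]
    exact Finset.single_le_sum (f := fun i => θ i * q i)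
      (fun k _ => mul_nonneg (hθ k).le (hq k)) (Finset.mem_univ i)

theorem nonempty_weightedSimplex [Nonempty ι] (hθ : ∀ i, 0 < θ i) (hw : 0 ≤ w) :
    (weightedSimplex θ w).Nonempty := by
  classical
  obtain ⟨i⟩ := ‹Nonempty ι›
  refine ⟨Pi.single i (w / θ i), fun k => ?_, ?_⟩
  · have : (0 : ι → ℝ) ≤ Pi.single i (w / θ i) := Pi.single_nonneg.2 (div_nonneg hw (hθ i).le)
    exact this k
  · simp [Pi.single_apply, mul_div_cancel₀ _ (hθ i).ne']

/-- Transferring all the weight of coordinate `j` to coordinate `i` stays in the simplex. -/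
theorem add_transfer_mem_weightedSimplex [DecidableEq ι] (hθ : ∀ i, 0 < θ i) {q : ι → ℝ}
    (hq : q ∈ weightedSimplex θ w) (i j : ι) :
    q + (Pi.single i (θ j * q j / θ i) - Pi.single j (q j)) ∈ weightedSimplex θ w := by
  refine ⟨fun k => ?_, ?_⟩
  · have h₁ : 0 ≤ (Pi.single i (θ j * q j / θ i) : ι → ℝ) k :=
      (Pi.single_nonneg (α := fun _ => ℝ) (i := i)).2
        (div_nonneg (mul_nonneg (hθ j).le (hq.1 j)) (hθ i).le) k
    have h₂ : (Pi.single j (q j) : ι → ℝ) k ≤ q k := by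
      rcases eq_or_ne k j with rfl | hk
      · simp
      · simpa [hk] using hq.1 k
    simp only [Pi.add_apply, Pi.sub_apply]
    linarith
  · simp [mul_add, mul_sub, Finset.sum_add_distrib, Finset.sum_sub_distrib, hq.2,
      Pi.single_apply, mul_div_cancel₀ _ (hθ i).ne']

variable {c : ι → CostFun}

/-- The first-order condition at a minimiser of the total cost over the simplex. -/
theorem inv_mul_deriv_le_of_isMinOn (hθ : ∀ i, 0 < θ i) {q : ι → ℝ}
    (hq : q ∈ weightedSimplex θ w)
    (hmin : IsMinOn (fun p : ι → ℝ => ∑ k, (c k).C (p k)) (weightedSimplex θ w) q) (i j : ι) :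
    (θ j)⁻¹ * (c j).C' (q j) ≤ (θ i)⁻¹ * (c i).C' (q i) := by
  classical
  rcases (hq.1 j).eq_or_lt with hj | hj
  · rw [← hj, (c j).deriv_zero, mul_zero]
    have := (c i).strictMonoOn_deriv.monotoneOn Set.self_mem_Ici (hq.1 i) (hq.1 i)
    rw [(c i).deriv_zero] at this
    exact mul_nonneg (inv_nonneg.2 (hθ i).le) this
  · have hd : HasFDerivWithinAt (fun p : ι → ℝ => ∑ k, (c k).C (p k))
        (∑ k, (c k).C' (q k) • ContinuousLinearMap.proj (R := ℝ) (φ := fun _ : ι => ℝ) k)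
        (weightedSimplex θ w) q :=
      HasFDerivWithinAt.fun_sum fun k _ =>
        ((c k).hasDeriv (q k) (hq.1 k)).comp_hasFDerivWithinAt q
          (hasFDerivWithinAt_apply k q _) fun p hp => hp.1 k
    have hcone := mem_posTangentConeAt_of_segment_subset
      (convex_weightedSimplex.segment_subset hq (add_transfer_mem_weightedSimplex hθ hq i j))
    have h := hmin.localize.hasFDerivWithinAt_nonneg hd hcone
    have hval : 0 ≤ (c i).C' (q i) * (θ j * q j / θ i) - (c j).C' (q j) * q j := by
      simpa [mul_sub, Finset.sum_sub_distrib, Pi.single_apply] using h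
    have hpos : 0 < θ j * q j := mul_pos (hθ j) hj
    refine le_of_mul_le_mul_left ?_ hpos
    have e : θ j * q j * ((θ j)⁻¹ * (c j).C' (q j)) = (c j).C' (q j) * q j := by
      have := (hθ j).ne'
      field_simp
    rw [e]
    calc (c j).C' (q j) * q j ≤ (c i).C' (q i) * (θ j * q j / θ i) := sub_nonneg.1 hval
      _ = _ := by ring

/-- Any two points of the simplex with balanced marginal costs are comparable (hence equal). -/
theorem le_of_balanced (hθ : ∀ i, 0 < θ i) {p q : ι → ℝ}
    (hp : p ∈ weightedSimplex θ w) (hq : q ∈ weightedSimplex θ w)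
    (hpb : ∀ i j, (θ i)⁻¹ * (c i).C' (p i) = (θ j)⁻¹ * (c j).C' (p j))
    (hqb : ∀ i j, (θ i)⁻¹ * (c i).C' (q i) = (θ j)⁻¹ * (c j).C' (q j)) : p ≤ q := by
  intro i
  by_contra! hi
  have hlt : ∀ j, q j < p j := fun j => by
    refine ((c j).strictMonoOn_deriv.lt_iff_lt (hq.1 j) (hp.1 j)).1 ?_
    refine lt_of_mul_lt_mul_left ?_ (inv_nonneg.2 (hθ j).le)
    rw [hqb j i, hpb j i]
    exact mul_lt_mul_of_pos_left ((c i).strictMonoOn_deriv (hq.1 i) (hp.1 i) hi)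
      (inv_pos.2 (hθ i))
  refine absurd (hq.2.trans hp.2.symm) (Finset.sum_lt_sum_of_nonempty ⟨i, Finset.mem_univ i⟩
    fun j _ => mul_lt_mul_of_pos_left (hlt j) (hθ j)).ne

end weightedSimplex

/-- For every `w ≥ 0` there exists a unique `q^w ∈ [0,∞)^d` such that
`θ·q^w = w` (with `θ_i = μ_i⁻¹`) and `μ_1 C_1'(q^w_1) = ⋯ = μ_d C_d'(q^w_d)`. -/
theorem exists_unique_qw
    (d : ℕ) (hd : 0 < d) (u₁ : ℝ) (hu₁ : 0 < u₁)
    (cf : Fin d → CostFun)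
    (hgrowth : ∀ i, ∀ x ≥ (0:ℝ), (cf i).C x ≤ u₁ * x)
    (μ : Fin d → ℝ) (hμ : ∀ i, 0 < μ i) :
    ∀ w ≥ (0:ℝ), ∃! q : Fin d → ℝ,
      (∀ i, 0 ≤ q i) ∧ (∑ i, (μ i)⁻¹ * q i = w) ∧
      (∀ i j, μ i * (cf i).C' (q i) = μ j * (cf j).C' (q j)) := by
  intro w hw
  have : Nonempty (Fin d) := ⟨⟨0, hd⟩⟩
  have hθ : ∀ i, 0 < (μ i)⁻¹ := fun i => inv_pos.2 (hμ i)
  have hcont : ContinuousOn (fun p : Fin d → ℝ => ∑ k, (cf k).C (p k))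
      (weightedSimplex (fun i => (μ i)⁻¹) w) :=
    continuousOn_finsetSum _ fun k _ =>
      (cf k).continuousOn.comp (continuous_apply k).continuousOn fun p hp => hp.1 k
  obtain ⟨q, hq, hmin⟩ := (isCompact_weightedSimplex hθ).exists_isMinOn
    (nonempty_weightedSimplex hθ hw) hcont
  have hle : ∀ i j, μ j * (cf j).C' (q j) ≤ μ i * (cf i).C' (q i) := fun i j => by
    simpa only [inv_inv] using inv_mul_deriv_le_of_isMinOn hθ hq hmin i j
  have hqb : ∀ i j, μ i * (cf i).C' (q i) = μ j * (cf j).C' (q j) :=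
    fun i j => (hle j i).antisymm (hle i j)
  refine ⟨q, ⟨hq.1, hq.2, hqb⟩, fun p ⟨hp, hpw, hpb⟩ => ?_⟩
  exact (le_of_balanced (c := cf) hθ ⟨hp, hpw⟩ hq (by simpa only [inv_inv] using hpb)
    (by simpa only [inv_inv] using hqb)).antisymm
    (le_of_balanced (c := cf) hθ hq ⟨hp, hpw⟩ (by simpa only [inv_inv] using hqb)
    (by simpa only [inv_inv] using hpb))
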